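/- For every finite real sequence y = (y_0, ..., y_m), the persistence distance is dominated by the discrete total variation: ‖y‖_per ≤ TV(y), with equality if and only if y is constant. -/

import Mathlib

/-- `x_l` is a (left-sided) local minimum knot of the sequence `y 0, …, y m`. -/
def IsLocalMinKnot (m : ℕ) (y : ℕ → ℝ) (l : ℕ) : Prop :=
  (l = 0 ∧ ∃ ν : ℕ, ν + 1 ≤ m ∧ (∀ i ≤ ν, y i = y 0) ∧ y 0 < y (ν + 1)) ∨
  (0 < l ∧ l < m ∧ y (l - 1) > y l ∧
    ∃ ν : ℕ, l + ν + 1 ≤ m ∧ (∀ i, l ≤ i → i ≤ l + ν → y i = y l) ∧ y l < y (l + ν + 1)) ∨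
  (l = m ∧ 0 < m ∧ y (m - 1) > y m)

/-- `x_l` is a (left-sided) local maximum knot of the sequence `y 0, …, y m`. -/
def IsLocalMaxKnot (m : ℕ) (y : ℕ → ℝ) (l : ℕ) : Prop :=
  (l = 0 ∧ ∃ ν : ℕ, ν + 1 ≤ m ∧ (∀ i ≤ ν, y i = y 0) ∧ y 0 > y (ν + 1)) ∨
  (0 < l ∧ l < m ∧ y (l - 1) < y l ∧
    ∃ ν : ℕ, l + ν + 1 ≤ m ∧ (∀ i, l ≤ i → i ≤ l + ν → y i = y l) ∧ y l > y (l + ν + 1)) ∨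
  (l = m ∧ 0 < m ∧ y (m - 1) < y m)

open Classical in
/-- The list of local minimum knots, in increasing index order. -/
noncomputable def minKnotList (m : ℕ) (y : ℕ → ℝ) : List ℕ :=
  (List.range (m + 1)).filter fun l => decide (IsLocalMinKnot m y l)

open Classical in
/-- The list of local maximum knots, in increasing index order. -/
noncomputable def maxKnotList (m : ℕ) (y : ℕ → ℝ) : List ℕ :=
  (List.range (m + 1)).filter fun l => decide (IsLocalMaxKnot m y l)

open Classical in
/-- Local maximum knots sorted by increasing value, ties broken by smaller index. -/
noncomputable def sortedMaxKnots (m : ℕ) (y : ℕ → ℝ) : List ℕ :=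
  (maxKnotList m y).mergeSort fun a b => decide (y a < y b ∨ (y a = y b ∧ a ≤ b))

/-- `I_max`: the extremum knot of highest index (`0` if there is no extremum knot). -/
noncomputable def imaxKnot (m : ℕ) (y : ℕ → ℝ) : ℕ :=
  ((minKnotList m y ++ maxKnotList m y).max?).getD 0

open Classical in
/-- One step of the persistence pairing algorithm (Algorithm 2): process the local maximum
knot `k`, pairing it with the neighbouring remaining local minimum knot whose value is
closer (ties broken by the larger knot), and remove that minimum from the remaining list. -/
noncomputable def pairStep (y : ℕ → ℝ) (imax : ℕ)
    (acc : List (ℕ × ℕ) × List ℕ) (k : ℕ) : List (ℕ × ℕ) × List ℕ :=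
  if k = 0 ∨ k = imax then acc
  else
    match (acc.2.filter fun j => decide (j < k)).max?,
          (acc.2.filter fun j => decide (k < j)).min? with
    | none, none => acc
    | some a, none => ((a, k) :: acc.1, acc.2.erase a)
    | none, some b => ((k, b) :: acc.1, acc.2.erase b)
    | some a, some b =>
        if |y k - y a| < |y k - y b| then ((a, k) :: acc.1, acc.2.erase a)
        else ((k, b) :: acc.1, acc.2.erase b)

/-- The multiset `P₁` of persistence pairs of `y` produced by Algorithm 2,
as a list of pairs of knots (each pair ordered by knot index). -/
noncomputable def pairsP1 (m : ℕ) (y : ℕ → ℝ) : List (ℕ × ℕ) :=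
  ((sortedMaxKnots m y).foldl (pairStep y (imaxKnot m y)) ([], minKnotList m y)).1

/-- The persistence distance `‖y‖_per`: the sum of the distances of function values over all
persistence pairs in `P₁` (pairs of `y`) and `P₂` (pairs of `-y`). -/
noncomputable def perDist (m : ℕ) (y : ℕ → ℝ) : ℝ :=
  ((pairsP1 m y).map fun p => |y p.2 - y p.1|).sum +
  ((pairsP1 m fun i => -(y i)).map fun p => |y p.2 - y p.1|).sum

/-- The discrete total variation `TV(y) = ∑_{j=0}^{m-1} |y_{j+1} - y_j|`. -/
noncomputable def discreteTV (m : ℕ) (y : ℕ → ℝ) : ℝ :=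
  ∑ j ∈ Finset.range m, |y (j + 1) - y j|

/-- The range `max_{0 ≤ j,k ≤ m} |y_j - y_k|` of the sequence `y 0, …, y m`. -/
noncomputable def seqRange (m : ℕ) (y : ℕ → ℝ) : ℝ :=
  ((Finset.range (m + 1)) ×ˢ (Finset.range (m + 1))).sup'
    (Finset.Nonempty.product ⟨0, Finset.mem_range.mpr (Nat.succ_pos m)⟩
      ⟨0, Finset.mem_range.mpr (Nat.succ_pos m)⟩)
    fun p => |y p.1 - y p.2|

/-- `R` and `U` interlace: every element of `U` lies strictly between two neighbouring elements of
`R`, on which `y` takes smaller values, and `R` has no further elements. -/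
structure Interlaced (y : ℕ → ℝ) (R U : List ℕ) : Prop where
  nodup_left : R.Nodup
  nodup_right : U.Nodup
  disjoint : ∀ k ∈ U, k ∉ R
  exists_lt : ∀ k ∈ U, ∃ a ∈ R, a < k
  exists_gt : ∀ k ∈ U, ∃ b ∈ R, k < b
  exists_between : ∀ k ∈ U, ∀ l ∈ U, k < l → ∃ c ∈ R, k < c ∧ c < l
  le_of_lt : ∀ k ∈ U, ∀ a ∈ R, a < k → (∀ c ∈ R, c < k → c ≤ a) → y a ≤ y k
  le_of_gt : ∀ k ∈ U, ∀ b ∈ R, k < b → (∀ c ∈ R, k < c → b ≤ c) → y b ≤ y k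
  length_eq : R.length = U.length + 1

namespace Interlaced

variable {y : ℕ → ℝ} {R U : List ℕ} {k a b : ℕ}

theorem of_perm {R' U' : List ℕ} (h : Interlaced y R U) (hR : R.Perm R') (hU : U.Perm U') :
    Interlaced y R' U' where
  nodup_left := hR.nodup h.nodup_left
  nodup_right := hU.nodup h.nodup_right
  disjoint := by simpa only [← hR.mem_iff, ← hU.mem_iff] using h.disjoint
  exists_lt := by simpa only [← hR.mem_iff, ← hU.mem_iff] using h.exists_lt
  exists_gt := by simpa only [← hR.mem_iff, ← hU.mem_iff] using h.exists_gt
  exists_between := by simpa only [← hR.mem_iff, ← hU.mem_iff] using h.exists_between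
  le_of_lt := by simpa only [← hR.mem_iff, ← hU.mem_iff] using h.le_of_lt
  le_of_gt := by simpa only [← hR.mem_iff, ← hU.mem_iff] using h.le_of_gt
  length_eq := by rw [← hR.length_eq, ← hU.length_eq, h.length_eq]

theorem erase_lower (h : Interlaced y R (k :: U)) (ha : a ∈ R) (hak : a < k)
    (ha' : ∀ c ∈ R, c < k → c ≤ a) (hb : b ∈ R) (hkb : k < b) (hb' : ∀ c ∈ R, k < c → b ≤ c)
    (hba : y b ≤ y a) : Interlaced y (R.erase a) U := by
  obtain ⟨h1, h2, h3, h4, h5, h6, h7, h8, h9⟩ := h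
  have hmem : ∀ c, c ∈ R.erase a ↔ c ≠ a ∧ c ∈ R := fun c => h1.mem_erase_iff
  have hkU : k ∉ U := (List.nodup_cons.1 h2).1
  have hlt : ∀ l ∈ U, l < k → l < a := by
    intro l hl hlk
    obtain ⟨c, hc, hlc, hck⟩ := h6 l (by simp [hl]) k (by simp) hlk
    exact hlc.trans_le (ha' c hc hck)
  have hgt : ∀ l ∈ U, k < l → b < l := by
    intro l hl hlk
    obtain ⟨c, hc, hlc, hck⟩ := h6 k (by simp) l (by simp [hl]) hlk
    exact (hb' c hc hlc).trans_lt hck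
  have hcase : ∀ l ∈ U, l < a ∨ b < l := by
    intro l hl
    rcases lt_trichotomy l k with h | h | h
    · exact Or.inl (hlt l hl h)
    · exact absurd (h ▸ hl) hkU
    · exact Or.inr (hgt l hl h)
  refine ⟨h1.erase a, (List.nodup_cons.1 h2).2, ?_, ?_, ?_, ?_, ?_, ?_, ?_⟩
  · intro l hl hc
    exact h3 l (by simp [hl]) ((hmem l).1 hc).2
  · intro l hl
    rcases hcase l hl with h | h
    · obtain ⟨c, hc, hcl⟩ := h4 l (by simp [hl])
      exact ⟨c, (hmem c).2 ⟨by omega, hc⟩, hcl⟩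
    · exact ⟨b, (hmem b).2 ⟨by omega, hb⟩, h⟩
  · intro l hl
    rcases hcase l hl with h | h
    · exact ⟨b, (hmem b).2 ⟨by omega, hb⟩, by omega⟩
    · obtain ⟨c, hc, hcl⟩ := h5 l (by simp [hl])
      exact ⟨c, (hmem c).2 ⟨by omega, hc⟩, hcl⟩
  · intro l hl l' hl' hll
    obtain ⟨c, hc, hlc, hcl⟩ := h6 l (by simp [hl]) l' (by simp [hl']) hll
    by_cases hca : c = a
    · rcases hcase l' hl' with h | h
      · omega
      · exact ⟨b, (hmem b).2 ⟨by omega, hb⟩, by omega, h⟩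
    · exact ⟨c, (hmem c).2 ⟨hca, hc⟩, hlc, hcl⟩
  · intro l hl c hc hcl hmax
    obtain ⟨hca, hcR⟩ := (hmem c).1 hc
    refine h7 l (by simp [hl]) c hcR hcl fun d hd hdl => ?_
    by_cases hda : d = a
    · rcases hcase l hl with h | h
      · omega
      · have := hmax b ((hmem b).2 ⟨by omega, hb⟩) h
        omega
    · exact hmax d ((hmem d).2 ⟨hda, hd⟩) hdl
  · intro l hl c hc hcl hmin
    obtain ⟨hca, hcR⟩ := (hmem c).1 hc
    by_cases hac : l < a ∧ a < c
    · have hcb : c = b := by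
        have h₁ := hmin b ((hmem b).2 ⟨by omega, hb⟩) (by omega)
        have hne : c ≠ k := fun h => h3 k (by simp) (h ▸ hcR)
        by_cases hck : c < k
        · have := ha' c hcR hck
          omega
        · have := hb' c hcR (by omega)
          omega
      rw [hcb]
      refine hba.trans (h8 l (by simp [hl]) a ha hac.1 fun d hd hld => ?_)
      by_cases hda : d = a
      · omega
      · have := hmin d ((hmem d).2 ⟨hda, hd⟩) hld
        omega
    · refine h8 l (by simp [hl]) c hcR hcl fun d hd hld => ?_
      by_cases hda : d = a
      · omega
      · exact hmin d ((hmem d).2 ⟨hda, hd⟩) hld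
  · rw [List.length_erase_of_mem ha, h9]
    simp

theorem erase_upper (h : Interlaced y R (k :: U)) (ha : a ∈ R) (hak : a < k)
    (ha' : ∀ c ∈ R, c < k → c ≤ a) (hb : b ∈ R) (hkb : k < b) (hb' : ∀ c ∈ R, k < c → b ≤ c)
    (hab : y a ≤ y b) : Interlaced y (R.erase b) U := by
  obtain ⟨h1, h2, h3, h4, h5, h6, h7, h8, h9⟩ := h
  have hmem : ∀ c, c ∈ R.erase b ↔ c ≠ b ∧ c ∈ R := fun c => h1.mem_erase_iff
  have hkU : k ∉ U := (List.nodup_cons.1 h2).1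
  have hcase : ∀ l ∈ U, l < a ∨ b < l := by
    intro l hl
    rcases lt_trichotomy l k with h | h | h
    · obtain ⟨c, hc, hlc, hck⟩ := h6 l (by simp [hl]) k (by simp) h
      exact Or.inl (hlc.trans_le (ha' c hc hck))
    · exact absurd (h ▸ hl) hkU
    · obtain ⟨c, hc, hlc, hck⟩ := h6 k (by simp) l (by simp [hl]) h
      exact Or.inr ((hb' c hc hlc).trans_lt hck)
  refine ⟨h1.erase b, (List.nodup_cons.1 h2).2, ?_, ?_, ?_, ?_, ?_, ?_, ?_⟩
  · intro l hl hc
    exact h3 l (by simp [hl]) ((hmem l).1 hc).2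
  · intro l hl
    rcases hcase l hl with h | h
    · obtain ⟨c, hc, hcl⟩ := h4 l (by simp [hl])
      exact ⟨c, (hmem c).2 ⟨by omega, hc⟩, hcl⟩
    · exact ⟨a, (hmem a).2 ⟨by omega, ha⟩, by omega⟩
  · intro l hl
    rcases hcase l hl with h | h
    · exact ⟨a, (hmem a).2 ⟨by omega, ha⟩, by omega⟩
    · obtain ⟨c, hc, hcl⟩ := h5 l (by simp [hl])
      exact ⟨c, (hmem c).2 ⟨by omega, hc⟩, hcl⟩
  · intro l hl l' hl' hll
    obtain ⟨c, hc, hlc, hcl⟩ := h6 l (by simp [hl]) l' (by simp [hl']) hll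
    by_cases hcb : c = b
    · rcases hcase l hl with h | h
      · exact ⟨a, (hmem a).2 ⟨by omega, ha⟩, by omega, by omega⟩
      · omega
    · exact ⟨c, (hmem c).2 ⟨hcb, hc⟩, hlc, hcl⟩
  · intro l hl c hc hcl hmax
    obtain ⟨hcb, hcR⟩ := (hmem c).1 hc
    by_cases hbc : c < b ∧ b < l
    · have hca : c = a := by
        have h₁ := hmax a ((hmem a).2 ⟨by omega, ha⟩) (by omega)
        have hne : c ≠ k := fun h => h3 k (by simp) (h ▸ hcR)
        by_cases hck : c < k
        · have := ha' c hcR hck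
          omega
        · have := hb' c hcR (by omega)
          omega
      rw [hca]
      refine hab.trans (h7 l (by simp [hl]) b hb hbc.2 fun d hd hdl => ?_)
      by_cases hdb : d = b
      · omega
      · have := hmax d ((hmem d).2 ⟨hdb, hd⟩) hdl
        omega
    · refine h7 l (by simp [hl]) c hcR hcl fun d hd hdl => ?_
      by_cases hdb : d = b
      · omega
      · exact hmax d ((hmem d).2 ⟨hdb, hd⟩) hdl
  · intro l hl c hc hcl hmin
    obtain ⟨hcb, hcR⟩ := (hmem c).1 hc
    refine h8 l (by simp [hl]) c hcR hcl fun d hd hld => ?_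
    by_cases hdb : d = b
    · rcases hcase l hl with h | h
      · have := hmin a ((hmem a).2 ⟨by omega, ha⟩) h
        omega
      · omega
    · exact hmin d ((hmem d).2 ⟨hdb, hd⟩) hld
  · rw [List.length_erase_of_mem hb, h9]
    simp

/-- Inserting a new lowest pair into an interlaced pair of lists. -/
theorem cons {c : ℕ} {t : List ℕ} (h : Interlaced y (c :: t) U) (hct : ∀ d ∈ t, c < d)
    (hU : ∀ l ∈ U, c < l) (hak : a < k) (hkc : k < c) (hya : y a < y k) (hyc : y c < y k) :
    Interlaced y (a :: c :: t) (k :: U) := by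
  obtain ⟨h1, h2, h3, h4, h5, h6, h7, h8, h9⟩ := h
  have hR : ∀ d ∈ c :: t, c ≤ d := by
    intro d hd
    rcases List.mem_cons.1 hd with rfl | hd
    · exact le_rfl
    · exact (hct d hd).le
  refine ⟨?_, ?_, ?_, ?_, ?_, ?_, ?_, ?_, ?_⟩
  · refine List.nodup_cons.2 ⟨fun hm => ?_, h1⟩
    have := hR a hm
    omega
  · refine List.nodup_cons.2 ⟨fun hm => ?_, h2⟩
    have := hU k hm
    omega
  · intro l hl hm
    rcases List.mem_cons.1 hl with rfl | hl <;> rcases List.mem_cons.1 hm with hm | hm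
    · omega
    · have := hR l hm
      omega
    · have := hU l hl
      omega
    · exact h3 l hl hm
  · intro l hl
    refine ⟨a, by simp, ?_⟩
    rcases List.mem_cons.1 hl with rfl | hl
    · exact hak
    · have := hU l hl
      omega
  · intro l hl
    rcases List.mem_cons.1 hl with rfl | hl
    · exact ⟨c, by simp, hkc⟩
    · obtain ⟨b, hb, hlb⟩ := h5 l hl
      exact ⟨b, List.mem_cons_of_mem _ hb, hlb⟩
  · intro l hl l' hl' hll
    rcases List.mem_cons.1 hl' with rfl | hlU
    · rcases List.mem_cons.1 hl with rfl | hl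
      · omega
      · have := hU l hl
        omega
    · rcases List.mem_cons.1 hl with rfl | hl
      · exact ⟨c, by simp, hkc, hU l' hlU⟩
      · obtain ⟨d, hd, hld⟩ := h6 l hl l' hlU hll
        exact ⟨d, List.mem_cons_of_mem _ hd, hld⟩
  · intro l hl d hd hdl hmax
    rcases List.mem_cons.1 hl with rfl | hl
    · rcases List.mem_cons.1 hd with rfl | hd
      · exact hya.le
      · have := hR d hd
        omega
    · have hcl := hU l hl
      have hcd := hmax c (by simp) hcl
      rcases List.mem_cons.1 hd with rfl | hd
      · omega
      · exact h7 l hl d hd hdl fun e he => hmax e (List.mem_cons_of_mem _ he)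
  · intro l hl d hd hld hmin
    rcases List.mem_cons.1 hl with rfl | hl
    · have hdc := hmin c (by simp) hkc
      rcases List.mem_cons.1 hd with rfl | hd
      · omega
      · have := hR d hd
        rw [show d = c by omega]
        exact hyc.le
    · have hcl := hU l hl
      rcases List.mem_cons.1 hd with rfl | hd
      · omega
      · exact h8 l hl d hd hld fun e he => hmin e (List.mem_cons_of_mem _ he)
  · simp [← h9]

end Interlaced

theorem foldl_pairStep_of_interlaced (y : ℕ → ℝ) (imax : ℕ) (L : List ℕ) :
    ∀ (R : List ℕ) (P : List (ℕ × ℕ)),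
      Interlaced y R (L.filter fun k => decide (k ≠ 0 ∧ k ≠ imax)) →
      ∃ r ∈ R, (∀ j ∈ R, y r ≤ y j) ∧
        (((L.foldl (pairStep y imax) (P, R)).1).map fun p => |y p.2 - y p.1|).sum =
          (P.map fun p => |y p.2 - y p.1|).sum +
            (((L.filter fun k => decide (k ≠ 0 ∧ k ≠ imax)).map y).sum - (R.map y).sum) + y r := by
  induction L with
  | nil =>
    intro R P h
    obtain ⟨r, rfl⟩ := List.length_eq_one_iff.1 h.length_eq
    exact ⟨r, by simp, by simp, by simp⟩
  | cons k L ih =>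
    intro R P h
    by_cases hk : k = 0 ∨ k = imax
    · have hf : (k :: L).filter (fun k => decide (k ≠ 0 ∧ k ≠ imax)) =
          L.filter fun k => decide (k ≠ 0 ∧ k ≠ imax) := by
        rw [List.filter_cons_of_neg]
        simpa [imp_iff_not_or] using hk
      rw [hf] at h ⊢
      simpa [List.foldl_cons, pairStep, hk] using ih R P h
    · have hf : (k :: L).filter (fun k => decide (k ≠ 0 ∧ k ≠ imax)) =
          k :: L.filter fun k => decide (k ≠ 0 ∧ k ≠ imax) := by
        rw [List.filter_cons_of_pos]
        simpa [not_or] using hk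
      rw [hf] at h ⊢
      obtain ⟨a₀, ha₀, hak₀⟩ := h.exists_lt k (by simp)
      obtain ⟨b₀, hb₀, hkb₀⟩ := h.exists_gt k (by simp)
      rcases hA : (R.filter fun j => decide (j < k)).max? with _ | a
      · have := List.max?_eq_none_iff.1 hA
        simp only [List.filter_eq_nil_iff, decide_eq_true_eq] at this
        exact absurd hak₀ (this a₀ ha₀)
      rcases hB : (R.filter fun j => decide (k < j)).min? with _ | b
      · have := List.min?_eq_none_iff.1 hB
        simp only [List.filter_eq_nil_iff, decide_eq_true_eq] at this
        exact absurd hkb₀ (this b₀ hb₀)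
      have hA' := List.max?_eq_some_iff.1 hA
      have hB' := List.min?_eq_some_iff.1 hB
      simp only [List.mem_filter, decide_eq_true_eq, and_imp] at hA' hB'
      obtain ⟨⟨ha, hak⟩, ha'⟩ := hA'
      obtain ⟨⟨hb, hkb⟩, hb'⟩ := hB'
      have hya := h.le_of_lt k (by simp) a ha hak ha'
      have hyb := h.le_of_gt k (by simp) b hb hkb hb'
      have habs_a : |y k - y a| = y k - y a := abs_of_nonneg (by linarith)
      have habs_b : |y k - y b| = y k - y b := abs_of_nonneg (by linarith)
      have hsum : ∀ c ∈ R, (R.map y).sum = y c + ((R.erase c).map y).sum := fun c hc => by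
        rw [((List.perm_cons_erase hc).map y).sum_eq]
        simp
      have hmem : ∀ {c d}, d ∈ R.erase c ↔ d ≠ c ∧ d ∈ R := h.nodup_left.mem_erase_iff
      by_cases hlt : |y k - y a| < |y k - y b|
      · have hba : y b ≤ y a := by linarith
        obtain ⟨r, hr, hmin, hs⟩ :=
          ih _ ((a, k) :: P) (h.erase_lower ha hak ha' hb hkb hb' hba)
        refine ⟨r, (hmem.1 hr).2, fun j hj => ?_, ?_⟩
        · by_cases hja : j = a
          · exact hja ▸ (hmin b (hmem.2 ⟨by omega, hb⟩)).trans hba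
          · exact hmin j (hmem.2 ⟨hja, hj⟩)
        · have : pairStep y imax (P, R) k = ((a, k) :: P, R.erase a) := by
            simp only [pairStep, hk, hA, hB, hlt, if_true, if_false]
          rw [List.foldl_cons, this, hs, hsum a ha]
          simp only [List.map_cons, List.sum_cons, habs_a]
          ring
      · have hab : y a ≤ y b := by linarith
        obtain ⟨r, hr, hmin, hs⟩ :=
          ih _ ((k, b) :: P) (h.erase_upper ha hak ha' hb hkb hb' hab)
        refine ⟨r, (hmem.1 hr).2, fun j hj => ?_, ?_⟩
        · by_cases hjb : j = b
          · exact hjb ▸ (hmin a (hmem.2 ⟨by omega, ha⟩)).trans hab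
          · exact hmin j (hmem.2 ⟨hjb, hj⟩)
        · have : pairStep y imax (P, R) k = ((k, b) :: P, R.erase b) := by
            simp only [pairStep, hk, hA, hB, hlt, if_false]
          rw [List.foldl_cons, this, hs, hsum b hb]
          simp only [List.map_cons, List.sum_cons, abs_sub_comm (y b), habs_b]
          ring

/-- The sublist of the entries of a list at even positions. -/
def evens : List ℕ → List ℕ
  | [] => []
  | [a] => [a]
  | a :: _ :: t => a :: evens t

theorem evens_cons (a : ℕ) (t : List ℕ) : evens (a :: t) = a :: evens t.tail := by
  cases t <;> simp [evens]

theorem evens_sublist : ∀ e : List ℕ, (evens e).Sublist e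
  | [] => by simp [evens]
  | [a] => by simp [evens]
  | a :: b :: t => by
    simpa [evens] using (evens_sublist t).trans (List.sublist_cons_self b t)

/-- `y` is strictly alternating along the increasing list of indices, starting with a rise. -/
def Rises : (ℕ → ℝ) → List ℕ → Prop
  | _, [] => True
  | _, [_] => True
  | y, a :: b :: t => a < b ∧ y a < y b ∧ Rises (-y) (b :: t)

namespace Rises

theorem of_cons {y : ℕ → ℝ} {a : ℕ} {t : List ℕ} (h : Rises y (a :: t)) : Rises (-y) t := by
  cases t with
  | nil => trivial
  | cons b t => exact h.2.2

theorem pairwise : ∀ {y : ℕ → ℝ} {e : List ℕ}, Rises y e → e.Pairwise (· < ·)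
  | _, [], _ => List.Pairwise.nil
  | _, [a], _ => by simp
  | y, a :: b :: t, h => by
    have ih := pairwise h.2.2
    refine List.pairwise_cons.2 ⟨fun c hc => ?_, ih⟩
    rcases List.mem_cons.1 hc with rfl | hc
    · exact h.1
    · exact h.1.trans ((List.pairwise_cons.1 ih).1 c hc)

theorem interlaced : ∀ {y : ℕ → ℝ} {a : ℕ} {t : List ℕ}, Rises y (a :: t) →
    Interlaced y (evens (a :: t)) (evens (a :: t).dropLast.tail)
  | y, a, [], _ => by constructor <;> simp [evens]
  | y, a, [b], _ => by constructor <;> simp [evens]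
  | y, a, b :: c :: t, h => by
    have hc : Rises y (c :: t) := by simpa using h.of_cons.of_cons
    have hp := h.pairwise
    simp only [List.pairwise_cons] at hp
    have := interlaced hc
    have hd : (c :: t).dropLast.tail = t.dropLast := by cases t <;> rfl
    rw [hd, evens_cons] at this
    have hlt : ∀ d ∈ t, c < d := hp.2.2.1
    have key := this.cons (a := a) (k := b)
      (fun d hd => hlt d ((List.tail_sublist t).subset ((evens_sublist _).subset hd)))
      (fun d hd => hlt d ((List.dropLast_sublist t).subset ((evens_sublist _).subset hd)))
      h.1 h.2.2.1 h.2.1 (by have := h.2.2.2.1; simpa using this)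
    have h1 : evens (a :: b :: c :: t) = a :: c :: evens t.tail := by
      simp [evens, evens_cons]
    have h2 : evens (a :: b :: c :: t).dropLast.tail = b :: evens t.dropLast := by
      cases t <;> simp [evens, evens_cons]
    rwa [h1, h2]

end Rises

/-- The variation of `y` along a list of indices. -/
def chainVariation (y : ℕ → ℝ) : List ℕ → ℝ
  | [] => 0
  | [_] => 0
  | a :: b :: t => |y b - y a| + chainVariation y (b :: t)

theorem chainVariation_neg (y : ℕ → ℝ) : ∀ e : List ℕ, chainVariation (-y) e = chainVariation y e
  | [] => rfl
  | [_] => rfl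
  | a :: b :: t => by
    simp only [chainVariation, chainVariation_neg y (b :: t), Pi.neg_apply]
    rw [← abs_neg]
    congr 2
    ring

theorem abs_sub_le_sum_Ico (y : ℕ → ℝ) {a b : ℕ} (h : a ≤ b) :
    |y b - y a| ≤ ∑ j ∈ Finset.Ico a b, |y (j + 1) - y j| := by
  rw [← Finset.sum_Ico_sub y h]
  exact Finset.abs_sum_le_sum_abs _ _

theorem chainVariation_le (y : ℕ → ℝ) (m : ℕ) : ∀ (a : ℕ) (t : List ℕ),
    (a :: t).Pairwise (· < ·) → (∀ l ∈ a :: t, l ≤ m) →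
    chainVariation y (a :: t) ≤ ∑ j ∈ Finset.Ico a m, |y (j + 1) - y j|
  | a, [], _, _ => Finset.sum_nonneg fun _ _ => abs_nonneg _
  | a, b :: t, hp, hm => by
    have hab : a < b := (List.pairwise_cons.1 hp).1 b (by simp)
    have hbm : b ≤ m := hm b (by simp)
    rw [← Finset.sum_Ico_consecutive _ hab.le hbm]
    exact add_le_add (abs_sub_le_sum_Ico y hab.le)
      (chainVariation_le y m b t (List.pairwise_cons.1 hp).2
        fun l hl => hm l (List.mem_cons_of_mem _ hl))

/-- The sum of the values at the inner odd positions minus the sum of the values at the even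
positions. -/
def pairingSum (y : ℕ → ℝ) (e : List ℕ) : ℝ :=
  ((evens e.dropLast.tail).map y).sum - ((evens e).map y).sum

theorem pairingSum_cons_cons (y : ℕ → ℝ) (a b c : ℕ) (t : List ℕ) :
    pairingSum y (a :: b :: c :: t) = y b - y a + pairingSum y (c :: t) := by
  cases t <;> simp [pairingSum, evens, evens_cons] <;> ring

theorem Rises.chainVariation_eq : ∀ {y : ℕ → ℝ} {a b : ℕ} {t : List ℕ},
    Rises y (a :: b :: t) →
    chainVariation y (a :: b :: t) = pairingSum y (a :: b :: t) + pairingSum (-y) (b :: t)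
  | y, a, b, [], h => by
    have : |y b - y a| = y b - y a := abs_of_pos (by linarith [h.2.1])
    simp [chainVariation, pairingSum, evens, this]
    ring
  | y, a, b, c :: t, h => by
    have hab : |y b - y a| = y b - y a := abs_of_pos (by linarith [h.2.1])
    rw [chainVariation, hab, ← chainVariation_neg, Rises.chainVariation_eq h.of_cons,
      pairingSum_cons_cons, neg_neg]
    ring

theorem mem_evens_dropLast : ∀ (a : ℕ) (t : List ℕ), (a :: t).Pairwise (· < ·) → ∀ k,
    k ∈ evens (a :: t).dropLast ↔ k ∈ evens (a :: t) ∧ k ≠ (a :: t).getLast (by simp)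
  | a, [], _, k => by simp [evens]
  | a, [b], h, k => by
    have : a < b := by simpa using h
    simp [evens]
    omega
  | a, b :: c :: t, h, k => by
    have hc := (List.pairwise_cons.1 (List.pairwise_cons.1 h).2).2
    have ih := mem_evens_dropLast c t hc k
    have hlt : a < (c :: t).getLast (by simp) :=
      (List.pairwise_cons.1 h).1 _ (List.mem_cons_of_mem _ (List.getLast_mem _))
    simp only [evens, List.dropLast_cons_cons, List.mem_cons, ih, List.getLast_cons_cons]
    constructor
    · rintro (rfl | h)
      · exact ⟨Or.inl rfl, hlt.ne⟩
      · exact ⟨Or.inr h.1, h.2⟩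
    · rintro ⟨h | h, hne⟩
      · exact Or.inl h
      · exact Or.inr ⟨h, hne⟩

/-- The first change of `y` at or after index `l` is a rise. -/
def RisesNext (m : ℕ) (y : ℕ → ℝ) (l : ℕ) : Prop :=
  ∃ ν : ℕ, l + ν + 1 ≤ m ∧ (∀ i, l ≤ i → i ≤ l + ν → y i = y l) ∧ y l < y (l + ν + 1)

theorem not_risesNext_self (m : ℕ) (y : ℕ → ℝ) : ¬RisesNext m y m := by
  rintro ⟨ν, h, -⟩
  omega

theorem risesNext_iff {m : ℕ} {y : ℕ → ℝ} {l : ℕ} (hl : l < m) :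
    RisesNext m y l ↔ y l < y (l + 1) ∨ y l = y (l + 1) ∧ RisesNext m y (l + 1) := by
  constructor
  · rintro ⟨ν, hν, hc, hlt⟩
    cases ν with
    | zero => exact Or.inl hlt
    | succ ν =>
      have h1 := hc (l + 1) (by omega) (by omega)
      refine Or.inr ⟨h1.symm, ν, by omega, fun i hi hi' => ?_, ?_⟩
      · rw [h1]
        exact hc i (by omega) (by omega)
      · rw [h1, show l + 1 + ν + 1 = l + (ν + 1) + 1 by omega]
        exact hlt
  · rintro (h | ⟨h, ν, hν, hc, hlt⟩)
    · refine ⟨0, by omega, fun i hi hi' => ?_, h⟩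
      rw [show i = l by omega]
    · refine ⟨ν + 1, by omega, fun i hi hi' => ?_, ?_⟩
      · rcases hi.eq_or_lt with rfl | hi
        · rfl
        · rw [h]
          exact hc i (by omega) (by omega)
      · rw [h, show l + (ν + 1) + 1 = l + 1 + ν + 1 by omega]
        exact hlt

theorem RisesNext.not_neg {m : ℕ} {y : ℕ → ℝ} {l : ℕ} (h : RisesNext m y l) :
    ¬RisesNext m (-y) l := by
  rintro ⟨μ, -, hc', hlt'⟩
  obtain ⟨ν, -, hc, hlt⟩ := h
  simp only [Pi.neg_apply, neg_inj, neg_lt_neg_iff] at hc' hlt'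
  rcases lt_trichotomy ν μ with h | rfl | h
  · exact hlt.ne' (hc' _ (by omega) (by omega))
  · exact lt_asymm hlt hlt'
  · exact hlt'.ne (hc _ (by omega) (by omega))

theorem isLocalMaxKnot_iff_neg (m : ℕ) (y : ℕ → ℝ) (l : ℕ) :
    IsLocalMaxKnot m y l ↔ IsLocalMinKnot m (-y) l := by
  simp only [IsLocalMaxKnot, IsLocalMinKnot, Pi.neg_apply, neg_inj, neg_lt_neg_iff, gt_iff_lt]

theorem isLocalMinKnot_zero (m : ℕ) (y : ℕ → ℝ) :
    IsLocalMinKnot m y 0 ↔ RisesNext m y 0 := by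
  simp only [IsLocalMinKnot, RisesNext, Nat.zero_le, true_and, zero_add, forall_true_left,
    lt_irrefl, false_and, false_or, or_iff_left_iff_imp]
  rintro ⟨rfl, h, -⟩
  exact absurd h (lt_irrefl 0)

theorem isLocalMinKnot_succ (m : ℕ) (y : ℕ → ℝ) (t : ℕ) :
    IsLocalMinKnot m y (t + 1) ↔
      y (t + 1) < y t ∧ (t + 1 = m ∨ RisesNext m y (t + 1)) := by
  constructor
  · rintro (⟨h, -⟩ | ⟨-, -, h, h'⟩ | ⟨rfl, -, h⟩)
    · omega
    · exact ⟨h, Or.inr h'⟩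
    · exact ⟨h, Or.inl rfl⟩
  · rintro ⟨h, rfl | h'⟩
    · exact Or.inr (Or.inr ⟨rfl, by omega, h⟩)
    · refine Or.inr (Or.inl ⟨by omega, ?_, h, h'⟩)
      obtain ⟨ν, hν, -⟩ := h'
      omega

theorem IsLocalMinKnot.le {m : ℕ} {y : ℕ → ℝ} {l : ℕ} (h : IsLocalMinKnot m y l) : l ≤ m := by
  rcases h with ⟨rfl, -⟩ | ⟨-, h, -⟩ | ⟨rfl, -⟩ <;> omega

/-- The knots of `y` after index `s` are the entries of the list `e`: maximum knots at even
positions, minimum knots at odd positions. -/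
structure IsKnotList (m : ℕ) (y : ℕ → ℝ) (s : ℕ) (e : List ℕ) : Prop where
  rises : Rises y (s :: e)
  mem_min : ∀ l, s < l → (IsLocalMinKnot m y l ↔ l ∈ evens e.tail)
  mem_max : ∀ l, s < l → (IsLocalMinKnot m (-y) l ↔ l ∈ evens e)

theorem Rises.replace_head {y : ℕ → ℝ} {a b : ℕ} {t : List ℕ} (h : Rises y (b :: t)) (hab : a ≤ b)
    (hy : y a ≤ y b) : Rises y (a :: t) := by
  cases t with
  | nil => trivial
  | cons c t => exact ⟨hab.trans_lt h.1, hy.trans_lt h.2.1, h.2.2⟩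

theorem IsKnotList.of_not_knot {m : ℕ} {y : ℕ → ℝ} {s : ℕ} {e : List ℕ}
    (h : IsKnotList m y (s + 1) e) (hy : y s ≤ y (s + 1)) (h₁ : ¬IsLocalMinKnot m y (s + 1))
    (h₂ : ¬IsLocalMinKnot m (-y) (s + 1)) : IsKnotList m y s e := by
  have hne : ∀ l ∈ e, s + 1 < l := (List.pairwise_cons.1 h.rises.pairwise).1
  refine ⟨h.rises.replace_head (Nat.le_succ s) hy, fun l hl => ?_, fun l hl => ?_⟩
  · rcases (Nat.succ_le_of_lt hl).eq_or_lt with rfl | hl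
    · refine iff_of_false h₁ fun hm => ?_
      exact (hne _ ((List.tail_sublist e).subset ((evens_sublist _).subset hm))).false
    · exact h.mem_min l hl
  · rcases (Nat.succ_le_of_lt hl).eq_or_lt with rfl | hl
    · exact iff_of_false h₂ fun hm => (hne _ ((evens_sublist _).subset hm)).false
    · exact h.mem_max l hl

theorem IsKnotList.cons {m : ℕ} {y : ℕ → ℝ} {s : ℕ} {e : List ℕ}
    (h : IsKnotList m (-y) (s + 1) e) (hy : y s < y (s + 1))
    (hk : IsLocalMinKnot m (-y) (s + 1)) : IsKnotList m y s ((s + 1) :: e) := by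
  have hne : ∀ l ∈ e, s + 1 < l := (List.pairwise_cons.1 h.rises.pairwise).1
  refine ⟨⟨by omega, hy, h.rises⟩, fun l hl => ?_, fun l hl => ?_⟩
  · rw [List.tail_cons]
    rcases (Nat.succ_le_of_lt hl).eq_or_lt with rfl | hl
    · refine iff_of_false (fun h' => ?_) fun hm => (hne _ ((evens_sublist _).subset hm)).false
      have := ((isLocalMinKnot_succ m y s).1 h').1
      linarith
    · simpa using h.mem_max l hl
  · rw [evens_cons, List.mem_cons]
    rcases (Nat.succ_le_of_lt hl).eq_or_lt with rfl | hl
    · exact iff_of_true hk (Or.inl rfl)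
    · rw [h.mem_min l hl]
      exact ⟨Or.inr, fun h' => h'.resolve_left (by omega)⟩

/-- The sequence is constant from index `s` on. -/
def ConstFrom (m : ℕ) (y : ℕ → ℝ) (s : ℕ) : Prop := ∀ i, s ≤ i → i ≤ m → y i = y s

theorem ConstFrom.neg {m : ℕ} {y : ℕ → ℝ} {s : ℕ} (h : ConstFrom m y s) :
    ConstFrom m (-y) s := fun i hi hi' => by simp [h i hi hi']

theorem ConstFrom.not_risesNext {m : ℕ} {y : ℕ → ℝ} {s : ℕ} (h : ConstFrom m y s) :
    ¬RisesNext m y s := by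
  rintro ⟨ν, hν, -, hlt⟩
  exact hlt.ne' (h _ (by omega) hν)

theorem ConstFrom.not_isLocalMinKnot {m : ℕ} {y : ℕ → ℝ} {s l : ℕ} (h : ConstFrom m y s)
    (hl : s < l) : ¬IsLocalMinKnot m y l := by
  intro hk
  have hlm := hk.le
  obtain ⟨t, rfl⟩ : ∃ t, l = t + 1 := ⟨l - 1, by omega⟩
  have := ((isLocalMinKnot_succ m y t).1 hk).1
  rw [h (t + 1) (by omega) hlm, h t (by omega) (by omega)] at this
  exact this.false

theorem exists_isKnotList_of_lt {m : ℕ} {y : ℕ → ℝ} {s : ℕ} (hs : s < m) (hy : y s < y (s + 1))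
    (h : ConstFrom m y (s + 1) ∨ (RisesNext m y (s + 1) ∧ ∃ e, IsKnotList m y (s + 1) e) ∨
      (RisesNext m (-y) (s + 1) ∧ ∃ e, IsKnotList m (-y) (s + 1) e)) :
    RisesNext m y s ∧ ∃ e, IsKnotList m y s e := by
  refine ⟨(risesNext_iff hs).2 (Or.inl hy), ?_⟩
  have hmin : ¬IsLocalMinKnot m y (s + 1) := fun h' => by
    have := ((isLocalMinKnot_succ m y s).1 h').1
    linarith
  have hneg : (-y) (s + 1) < (-y) s := by simpa using hy
  rcases h with hc | ⟨hr, e, he⟩ | ⟨hr, e, he⟩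
  · have hnil : ∀ z : ℕ → ℝ, ConstFrom m z (s + 1) → IsKnotList m z (s + 1) [] := fun z hz =>
      ⟨trivial, fun l hl => by simpa [evens] using hz.not_isLocalMinKnot hl,
        fun l hl => by simpa [evens] using hz.neg.not_isLocalMinKnot hl⟩
    by_cases hsm : s + 1 = m
    · exact ⟨_, (hnil _ hc.neg).cons hy ((isLocalMinKnot_succ m (-y) s).2 ⟨hneg, Or.inl hsm⟩)⟩
    · refine ⟨_, (hnil _ hc).of_not_knot hy.le hmin fun h' => ?_⟩
      rcases ((isLocalMinKnot_succ m (-y) s).1 h').2 with h' | h'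
      · exact hsm h'
      · exact hc.neg.not_risesNext h'
  · refine ⟨e, he.of_not_knot hy.le hmin fun h' => ?_⟩
    rcases ((isLocalMinKnot_succ m (-y) s).1 h').2 with h' | h'
    · rw [h'] at hr
      exact not_risesNext_self m y hr
    · exact hr.not_neg h'
  · exact ⟨_, he.cons hy ((isLocalMinKnot_succ m (-y) s).2 ⟨hneg, Or.inr hr⟩)⟩

theorem exists_isKnotList_of_eq {m : ℕ} {y : ℕ → ℝ} {s : ℕ} (hs : s < m) (hy : y s = y (s + 1))
    (h : RisesNext m y (s + 1) ∧ ∃ e, IsKnotList m y (s + 1) e) :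
    RisesNext m y s ∧ ∃ e, IsKnotList m y s e := by
  obtain ⟨hr, e, he⟩ := h
  refine ⟨(risesNext_iff hs).2 (Or.inr ⟨hy, hr⟩), e, he.of_not_knot hy.le (fun h' => ?_)
    fun h' => ?_⟩
  · exact ((isLocalMinKnot_succ m y s).1 h').1.ne' hy
  · exact ((isLocalMinKnot_succ m (-y) s).1 h').1.ne' (by simpa using hy)

theorem constFrom_or_exists_isKnotList (m : ℕ) (y : ℕ → ℝ) {s : ℕ} (hs : s ≤ m) :
    ConstFrom m y s ∨ (RisesNext m y s ∧ ∃ e, IsKnotList m y s e) ∨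
      (RisesNext m (-y) s ∧ ∃ e, IsKnotList m (-y) s e) := by
  induction hs using Nat.decreasingInduction with
  | self => exact Or.inl fun i hi hi' => by rw [le_antisymm hi hi']
  | of_succ s hs ih =>
    rcases lt_trichotomy (y s) (y (s + 1)) with hy | hy | hy
    · exact Or.inr (Or.inl (exists_isKnotList_of_lt hs hy ih))
    · rcases ih with hc | h | h
      · refine Or.inl fun i hi hi' => ?_
        rcases hi.eq_or_lt with rfl | hi
        · rfl
        · rw [hy, hc i hi hi']
      · exact Or.inr (Or.inl (exists_isKnotList_of_eq hs hy h))
      · exact Or.inr (Or.inr (exists_isKnotList_of_eq hs (by simpa using hy) h))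
    · refine Or.inr (Or.inr (exists_isKnotList_of_lt hs (by simpa using hy) ?_))
      rw [neg_neg]
      rcases ih with hc | h | h
      · exact Or.inl hc.neg
      · exact Or.inr (Or.inr h)
      · exact Or.inr (Or.inl h)

theorem mem_evens_or_mem_evens_tail : ∀ (e : List ℕ) (l : ℕ),
    l ∈ evens e ∨ l ∈ evens e.tail ↔ l ∈ e
  | [], l => by simp [evens]
  | a :: t, l => by
    rw [evens_cons, List.tail_cons, List.mem_cons, List.mem_cons,
      ← mem_evens_or_mem_evens_tail t l, or_assoc, or_comm (a := l ∈ evens t)]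

theorem mem_minKnotList {m : ℕ} {y : ℕ → ℝ} {l : ℕ} :
    l ∈ minKnotList m y ↔ IsLocalMinKnot m y l := by
  simp only [minKnotList, List.mem_filter, List.mem_range, decide_eq_true_eq,
    and_iff_right_iff_imp]
  exact fun h => Nat.lt_succ_of_le h.le

theorem nodup_minKnotList (m : ℕ) (y : ℕ → ℝ) : (minKnotList m y).Nodup :=
  List.nodup_range.filter _

theorem maxKnotList_eq (m : ℕ) (y : ℕ → ℝ) : maxKnotList m y = minKnotList m (-y) :=
  List.filter_congr fun l _ => decide_eq_decide.2 (isLocalMaxKnot_iff_neg m y l)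

theorem sortedMaxKnots_perm (m : ℕ) (y : ℕ → ℝ) :
    (sortedMaxKnots m y).Perm (minKnotList m (-y)) := by
  rw [← maxKnotList_eq]
  exact List.mergeSort_perm _ _

theorem exists_sum_pairsP1_eq {m : ℕ} {y : ℕ → ℝ} {R U : List ℕ} (h : Interlaced y R U)
    (hR : (minKnotList m y).Perm R)
    (hU : ∀ k, k ∈ U ↔ IsLocalMinKnot m (-y) k ∧ k ≠ 0 ∧ k ≠ imaxKnot m y) :
    ∃ r ∈ R, (∀ j ∈ R, y r ≤ y j) ∧
      ((pairsP1 m y).map fun p => |y p.2 - y p.1|).sum =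
        (U.map y).sum - (R.map y).sum + y r := by
  have hU' : U.Perm ((sortedMaxKnots m y).filter fun k =>
      decide (k ≠ 0 ∧ k ≠ imaxKnot m y)) := by
    refine (List.perm_ext_iff_of_nodup h.nodup_right ?_).2 fun k => ?_
    · exact ((sortedMaxKnots_perm m y).symm.nodup (nodup_minKnotList m _)).filter _
    · rw [hU, List.mem_filter, (sortedMaxKnots_perm m y).mem_iff, mem_minKnotList,
        decide_eq_true_eq]
  obtain ⟨r, hr, hmin, hs⟩ :=
    foldl_pairStep_of_interlaced y (imaxKnot m y) (sortedMaxKnots m y) _ [] (h.of_perm hR.symm hU')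
  refine ⟨r, hR.mem_iff.1 hr, fun j hj => hmin j (hR.mem_iff.2 hj), ?_⟩
  rw [pairsP1, hs, (hU'.map y).sum_eq, (hR.map y).sum_eq]
  simp

theorem perDist_eq (m : ℕ) (y : ℕ → ℝ) :
    perDist m y = ((pairsP1 m y).map fun p => |y p.2 - y p.1|).sum +
      ((pairsP1 m (-y)).map fun p => |(-y) p.2 - (-y) p.1|).sum := by
  have : ∀ p : ℕ × ℕ, |(-y) p.2 - (-y) p.1| = |y p.2 - y p.1| := fun p => by
    rw [← abs_neg]
    congr 1
    simp only [Pi.neg_apply]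
    ring
  simp only [this]
  rfl

theorem perDist_neg (m : ℕ) (y : ℕ → ℝ) : perDist m (-y) = perDist m y := by
  rw [perDist_eq, perDist_eq, neg_neg, add_comm]

theorem discreteTV_neg (m : ℕ) (y : ℕ → ℝ) : discreteTV m (-y) = discreteTV m y := by
  refine Finset.sum_congr rfl fun j _ => ?_
  rw [← abs_neg]
  congr 1
  simp only [Pi.neg_apply]
  ring

theorem RisesNext.discreteTV_pos {m : ℕ} {y : ℕ → ℝ} (h : RisesNext m y 0) :
    0 < discreteTV m y := by
  obtain ⟨ν, hν, -, hlt⟩ := h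
  calc 0 < |y (0 + ν + 1) - y 0| := abs_pos.2 (sub_ne_zero.2 hlt.ne')
    _ ≤ ∑ j ∈ Finset.Ico 0 (0 + ν + 1), |y (j + 1) - y j| := abs_sub_le_sum_Ico y (Nat.zero_le _)
    _ ≤ discreteTV m y := by
      rw [discreteTV, Finset.range_eq_Ico]
      exact Finset.sum_le_sum_of_subset_of_nonneg (Finset.Ico_subset_Ico_right hν)
        fun _ _ _ => abs_nonneg _

section KnotList

variable {m : ℕ} {y : ℕ → ℝ} {t : List ℕ}

theorem IsKnotList.isLocalMinKnot_iff (h : IsKnotList m y 0 t) (hr : RisesNext m y 0) (l : ℕ) :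
    IsLocalMinKnot m y l ↔ l ∈ evens (0 :: t) := by
  rw [evens_cons, List.mem_cons]
  rcases Nat.eq_zero_or_pos l with rfl | hl
  · exact iff_of_true ((isLocalMinKnot_zero m y).2 hr) (Or.inl rfl)
  · rw [h.mem_min l hl]
    exact ⟨Or.inr, fun h' => h'.resolve_left hl.ne'⟩

theorem IsKnotList.isLocalMinKnot_neg_iff (h : IsKnotList m y 0 t) (hr : RisesNext m y 0) (l : ℕ) :
    IsLocalMinKnot m (-y) l ↔ l ∈ evens t := by
  rcases Nat.eq_zero_or_pos l with rfl | hl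
  · refine iff_of_false (fun h' => hr.not_neg ((isLocalMinKnot_zero m (-y)).1 h')) fun h' => ?_
    exact ((List.pairwise_cons.1 h.rises.pairwise).1 0 ((evens_sublist t).subset h')).false
  · exact h.mem_max l hl

theorem IsKnotList.imaxKnot_eq (h : IsKnotList m y 0 t) (hr : RisesNext m y 0) :
    imaxKnot m y = (0 :: t).getLast (by simp) := by
  have hmem : ∀ l, l ∈ minKnotList m y ++ maxKnotList m y ↔ l ∈ 0 :: t := fun l => by
    rw [List.mem_append, maxKnotList_eq, mem_minKnotList, mem_minKnotList,
      h.isLocalMinKnot_iff hr, h.isLocalMinKnot_neg_iff hr]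
    exact mem_evens_or_mem_evens_tail (0 :: t) l
  have : (minKnotList m y ++ maxKnotList m y).max? = some ((0 :: t).getLast (by simp)) := by
    refine List.max?_eq_some_iff.2 ⟨(hmem _).2 (List.getLast_mem _), fun l hl => ?_⟩
    exact (h.rises.pairwise.imp fun h => h.le).rel_getLast ((hmem l).1 hl)
  rw [imaxKnot, this, Option.getD_some]

theorem imaxKnot_neg (m : ℕ) (y : ℕ → ℝ) : imaxKnot m (-y) = imaxKnot m y := by
  have : (minKnotList m (-y) ++ minKnotList m y).max? =
      (minKnotList m y ++ minKnotList m (-y)).max? := by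
    refine Option.ext fun a => ?_
    simp only [List.max?_eq_some_iff, List.mem_append, or_comm]
  rw [imaxKnot, imaxKnot, maxKnotList_eq, maxKnotList_eq, neg_neg, this]

theorem IsKnotList.perDist_lt_discreteTV (h : IsKnotList m y 0 t) (hr : RisesNext m y 0) :
    perDist m y < discreteTV m y := by
  have hp := h.rises.pairwise
  have hp' := (List.pairwise_cons.1 hp).2
  have hmin : (minKnotList m y).Perm (evens (0 :: t)) :=
    (List.perm_ext_iff_of_nodup (nodup_minKnotList m y)
      (h.rises.interlaced.nodup_left)).2 fun l => by
        rw [mem_minKnotList, h.isLocalMinKnot_iff hr]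
  cases t with
  | nil =>
    have hmin' : (minKnotList m y).Perm [0] := hmin
    have h₁ : sortedMaxKnots m y = [] := by
      refine List.eq_nil_iff_forall_not_mem.2 fun l hl => ?_
      rw [(sortedMaxKnots_perm m y).mem_iff, mem_minKnotList, h.isLocalMinKnot_neg_iff hr] at hl
      simp [evens] at hl
    have h₂ : sortedMaxKnots m (-y) = [0] := by
      refine List.perm_singleton.1 ((sortedMaxKnots_perm m (-y)).trans ?_)
      rwa [neg_neg]
    rw [perDist_eq, pairsP1, pairsP1, h₁, h₂]
    simpa [pairStep] using hr.discreteTV_pos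
  | cons b t =>
    have hmax : (minKnotList m (-y)).Perm (evens (b :: t)) :=
      (List.perm_ext_iff_of_nodup (nodup_minKnotList m _)
        (h.rises.of_cons.interlaced.nodup_left)).2 fun l => by
          rw [mem_minKnotList, h.isLocalMinKnot_neg_iff hr]
    have hpos : ∀ k ∈ b :: t, 0 < k := (List.pairwise_cons.1 hp).1
    have himax : imaxKnot m y = (b :: t).getLast (by simp) := by
      rw [h.imaxKnot_eq hr, List.getLast_cons_cons]
    obtain ⟨r, hrm, hrmin, hs₁⟩ := exists_sum_pairsP1_eq h.rises.interlaced hmin fun k => by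
      rw [List.dropLast_cons_cons, List.tail_cons, mem_evens_dropLast b t hp',
        h.isLocalMinKnot_neg_iff hr, himax]
      refine and_congr_right fun hk => (and_iff_right ?_).symm
      exact (hpos k ((evens_sublist _).subset hk)).ne'
    obtain ⟨M, hMm, hMmin, hs₂⟩ := exists_sum_pairsP1_eq h.rises.of_cons.interlaced hmax
      fun k => by
        rw [neg_neg, h.isLocalMinKnot_iff hr, imaxKnot_neg, himax, evens_cons, List.tail_cons,
          List.mem_cons]
        cases t with
        | nil => simp +contextual [evens]
        | cons c t =>
          rw [List.dropLast_cons_cons, List.tail_cons,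
            mem_evens_dropLast c t (List.pairwise_cons.1 hp').2, List.getLast_cons_cons]
          constructor
          · rintro ⟨hk, hne⟩
            refine ⟨Or.inr hk, (hpos k ?_).ne', hne⟩
            exact List.mem_cons_of_mem _ ((evens_sublist _).subset hk)
          · rintro ⟨hk, hk0, hne⟩
            exact ⟨hk.resolve_left hk0, hne⟩
    have hchain := h.rises.chainVariation_eq
    have hle : chainVariation y (0 :: b :: t) ≤ discreteTV m y := by
      rw [discreteTV, Finset.range_eq_Ico]
      refine chainVariation_le y m 0 _ hp fun l hl => ?_
      rcases (mem_evens_or_mem_evens_tail _ l).2 hl with hl | hl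
      · exact ((h.isLocalMinKnot_iff hr l).2 hl).le
      · exact ((h.isLocalMinKnot_neg_iff hr l).2 hl).le
    have hr0 : y r ≤ y 0 := hrmin 0 (by simp [evens_cons])
    have hMb : (-y) M ≤ (-y) b := hMmin b (by simp [evens_cons])
    have h0b : y 0 < y b := h.rises.2.1
    rw [perDist_eq, hs₁, hs₂]
    rw [pairingSum, pairingSum] at hchain
    simp only [Pi.neg_apply] at hMb ⊢
    linarith

end KnotList

theorem ConstFrom.perDist_eq_zero {m : ℕ} {y : ℕ → ℝ} (h : ConstFrom m y 0) :
    perDist m y = 0 := by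
  have hnil : ∀ z : ℕ → ℝ, ConstFrom m z 0 → minKnotList m z = [] := fun z hz => by
    refine List.eq_nil_iff_forall_not_mem.2 fun l hl => ?_
    rw [mem_minKnotList] at hl
    rcases Nat.eq_zero_or_pos l with rfl | hpos
    · exact hz.not_risesNext ((isLocalMinKnot_zero m z).1 hl)
    · exact hz.not_isLocalMinKnot hpos hl
  have hsort : ∀ z : ℕ → ℝ, ConstFrom m z 0 → sortedMaxKnots m z = [] := fun z hz =>
    List.perm_nil.1 ((sortedMaxKnots_perm m z).trans (by rw [hnil _ hz.neg]))
  rw [perDist_eq, pairsP1, pairsP1, hsort _ h, hsort _ h.neg]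
  simp

theorem ConstFrom.discreteTV_eq_zero {m : ℕ} {y : ℕ → ℝ} (h : ConstFrom m y 0) :
    discreteTV m y = 0 := by
  refine Finset.sum_eq_zero fun j hj => ?_
  have hj := Finset.mem_range.1 hj
  rw [h (j + 1) (by omega) (by omega), h j (by omega) (by omega), sub_self, abs_zero]

/-- `‖y‖_per ≤ TV(y)`, with equality if and only if the sequence
`y 0, …, y m` is constant. -/
theorem perDist_le_tv_iff_const (m : ℕ) (y : ℕ → ℝ) :
    perDist m y ≤ discreteTV m y ∧
    (perDist m y = discreteTV m y ↔ ∀ i ≤ m, y i = y 0) := by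
  have hstrict : perDist m y < discreteTV m y → ¬ConstFrom m y 0 := fun hlt hc => by
    rw [hc.perDist_eq_zero, hc.discreteTV_eq_zero] at hlt
    exact hlt.false
  have hconst : ConstFrom m y 0 ↔ ∀ i ≤ m, y i = y 0 :=
    ⟨fun h i hi => h i (Nat.zero_le i) hi, fun h i _ hi => h i hi⟩
  rw [← hconst]
  have key : ConstFrom m y 0 ∨ perDist m y < discreteTV m y := by
    rcases constFrom_or_exists_isKnotList m y (Nat.zero_le m) with hc | ⟨hr, e, he⟩ | ⟨hr, e, he⟩
    · exact Or.inl hc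
    · exact Or.inr (he.perDist_lt_discreteTV hr)
    · have := he.perDist_lt_discreteTV hr
      rw [perDist_neg, discreteTV_neg] at this
      exact Or.inr this
  rcases key with hc | hlt
  · have heq : perDist m y = discreteTV m y := by
      rw [hc.perDist_eq_zero, hc.discreteTV_eq_zero]
    exact ⟨heq.le, iff_of_true heq hc⟩
  · exact ⟨hlt.le, iff_of_false hlt.ne (hstrict hlt)⟩
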